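/- Let 𝒜 = (I, (A_a)_{a∈Σ}, F) be a minimal uniformly convergent WFA whose ω-function f_𝒜 is not identically zero, and for w ∈ Σ^ω let A_w = lim_{k→∞} A_{pref_k(w)}. Then for every w ∈ Σ^ω the row space of A_w (the span of its rows in ℝⁿ) is one-dimensional, and moreover this row space is the same subspace for all w ∈ Σ^ω. -/

import Mathlib

open Filter Topology Matrix

/-- The prefix of length `k` of an infinite word `w`. -/
def pref {A : Type*} (w : ℕ → A) (k : ℕ) : List A := (List.range k).map w

/-- The product `A_{v₁} ⋯ A_{v_k}` of matrices along a finite word `v`. -/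
def wordProd {A : Type*} {n : ℕ} (M : A → Matrix (Fin n) (Fin n) ℝ) (v : List A) :
    Matrix (Fin n) (Fin n) ℝ := (v.map M).prod

/-- The word function of the WFA `(I, M, F)`: `v ↦ I A_v F`. -/
def wfaWord {A : Type*} {n : ℕ} (I : Fin n → ℝ) (M : A → Matrix (Fin n) (Fin n) ℝ)
    (F : Fin n → ℝ) (v : List A) : ℝ := I ⬝ᵥ (wordProd M v) *ᵥ F

/-- The WFA with `n` states is left minimal: the row vectors `I A_u` span `ℝⁿ`. -/
def LeftMinimal {A : Type*} {n : ℕ} (I : Fin n → ℝ)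
    (M : A → Matrix (Fin n) (Fin n) ℝ) : Prop :=
  Submodule.span ℝ {x : Fin n → ℝ | ∃ u : List A, x = I ᵥ* (wordProd M u)} = ⊤

/-- The WFA with `n` states is right minimal: the column vectors `A_u F` span `ℝⁿ`. -/
def RightMinimal {A : Type*} {n : ℕ} (M : A → Matrix (Fin n) (Fin n) ℝ)
    (F : Fin n → ℝ) : Prop :=
  Submodule.span ℝ {x : Fin n → ℝ | ∃ u : List A, x = (wordProd M u) *ᵥ F} = ⊤

/-- A word function `F : Σ* → ℝ` is uniformly convergent with ω-function `f`. -/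
def UnifConv {A : Type*} (F : List A → ℝ) (f : (ℕ → A) → ℝ) : Prop :=
  (∀ w : ℕ → A, Tendsto (fun k => F (pref w k)) atTop (𝓝 (f w))) ∧
  ∀ ε > (0 : ℝ), ∃ k₀ : ℕ, ∀ w : ℕ → A, ∀ k > k₀, |F (pref w k) - f w| < ε

@[simp]
lemma length_pref {A : Type*} (w : ℕ → A) (k : ℕ) : (pref w k).length = k := by
  simp [pref]

lemma pref_cons_succ {A : Type*} (a : A) (w : ℕ → A) (k : ℕ) :
    pref (fun i => Nat.casesOn i a w) (k + 1) = a :: pref w k := by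
  simp [pref, List.range_succ_eq_map, Function.comp_def]

/-- A finite word followed by an infinite word is again an infinite word. -/
lemma exists_pref_append {A : Type*} (x : List A) (w : ℕ → A) :
    ∃ w' : ℕ → A, ∀ k, pref w' (x.length + k) = x ++ pref w k := by
  induction x with
  | nil => exact ⟨w, by simp⟩
  | cons a x ih =>
    obtain ⟨w', hw'⟩ := ih
    refine ⟨fun i => Nat.casesOn i a w', fun k => ?_⟩
    rw [List.length_cons, add_right_comm, pref_cons_succ, hw', List.cons_append]

/-- Every finite word extends to an infinite one, compatibly with a chosen prefix. -/
lemma exists_pref_eq_append {A : Type*} [Nonempty A] (x y : List A) :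
    ∃ w : ℕ → A, pref w x.length = x ∧ pref w (x.length + y.length) = x ++ y := by
  obtain ⟨w₁, h₁⟩ := exists_pref_append y fun _ => Classical.arbitrary A
  obtain ⟨w, h⟩ := exists_pref_append x w₁
  refine ⟨w, by simpa [pref] using h 0, ?_⟩
  rw [h]
  congr 1
  simpa [pref] using h₁ 0

lemma UnifConv.exists_abs_append_sub_lt {A : Type*} [Nonempty A] {G : List A → ℝ}
    {f : (ℕ → A) → ℝ} (hG : UnifConv G f) {ε : ℝ} (hε : 0 < ε) :
    ∃ k₀ : ℕ, ∀ x y : List A, k₀ < x.length → |G (x ++ y) - G x| < ε := by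
  obtain ⟨k₀, hk₀⟩ := hG.2 (ε / 2) (half_pos hε)
  refine ⟨k₀, fun x y hx => ?_⟩
  obtain ⟨w, hw, hw'⟩ := exists_pref_eq_append x y
  have h := hk₀ w _ hx
  have h' := hk₀ w (x.length + y.length) (by omega)
  rw [hw] at h
  rw [hw'] at h'
  rw [abs_lt] at *
  constructor <;> linarith

lemma UnifConv.tendsto_append_sub {A : Type*} [Nonempty A] {G : List A → ℝ}
    {f : (ℕ → A) → ℝ} (hG : UnifConv G f) (u v : List A) (w : ℕ → A) :
    Tendsto (fun k => G (u ++ pref w k ++ v) - G (u ++ pref w k)) atTop (𝓝 0) := by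
  rw [Metric.tendsto_atTop]
  intro ε hε
  obtain ⟨k₀, hk₀⟩ := hG.exists_abs_append_sub_lt hε
  refine ⟨k₀ + 1, fun k hk => ?_⟩
  rw [Real.dist_0_eq_abs]
  apply hk₀
  simp only [List.length_append, length_pref]
  omega

lemma wordProd_append {A : Type*} {n : ℕ} (M : A → Matrix (Fin n) (Fin n) ℝ) (u v : List A) :
    wordProd M (u ++ v) = wordProd M u * wordProd M v := by
  simp [wordProd]

lemma LeftMinimal.eq_of_dotProduct_eq {A : Type*} {n : ℕ} {I : Fin n → ℝ}
    {M : A → Matrix (Fin n) (Fin n) ℝ} (hl : LeftMinimal I M) {x y : Fin n → ℝ}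
    (h : ∀ u, (I ᵥ* wordProd M u) ⬝ᵥ x = (I ᵥ* wordProd M u) ⬝ᵥ y) : x = y := by
  refine dotProduct_eq _ _ fun z => ?_
  have hz : z ∈ Submodule.span ℝ {x : Fin n → ℝ | ∃ u : List A, x = I ᵥ* (wordProd M u)} := by
    rw [hl]; trivial
  rw [dotProduct_comm x, dotProduct_comm y]
  induction hz using Submodule.span_induction with
  | mem z hz => obtain ⟨u, rfl⟩ := hz; exact h u
  | zero => simp
  | add a b _ _ ha hb => rw [add_dotProduct, add_dotProduct, ha, hb]
  | smul c a _ ha => rw [smul_dotProduct, smul_dotProduct, ha]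

lemma RightMinimal.eq_of_dotProduct_eq {A : Type*} {n : ℕ} {F : Fin n → ℝ}
    {M : A → Matrix (Fin n) (Fin n) ℝ} (hr : RightMinimal M F) {x y : Fin n → ℝ}
    (h : ∀ v, x ⬝ᵥ (wordProd M v *ᵥ F) = y ⬝ᵥ (wordProd M v *ᵥ F)) : x = y := by
  refine dotProduct_eq _ _ fun z => ?_
  have hz : z ∈ Submodule.span ℝ {x : Fin n → ℝ | ∃ v : List A, x = (wordProd M v) *ᵥ F} := by
    rw [hr]; trivial
  induction hz using Submodule.span_induction with
  | mem z hz => obtain ⟨v, rfl⟩ := hz; exact h v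
  | zero => simp
  | add a b _ _ ha hb => rw [dotProduct_add, dotProduct_add, ha, hb]
  | smul c a _ ha => rw [dotProduct_smul, dotProduct_smul, ha]

lemma continuous_dotProduct_mulVec {m n : ℕ} (x : Fin m → ℝ) (y : Fin n → ℝ) :
    Continuous fun B : Matrix (Fin m) (Fin n) ℝ => x ⬝ᵥ B *ᵥ y := by
  fun_prop

/-- The limit matrix `A_w` identifies all the vectors `A_v F`. -/
lemma UnifConv.mulVec_wordProd_mulVec {A : Type*} [Nonempty A] {n : ℕ} {I : Fin n → ℝ}
    {M : A → Matrix (Fin n) (Fin n) ℝ} {F : Fin n → ℝ} {f : (ℕ → A) → ℝ}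
    (hA : UnifConv (wfaWord I M F) f) (hl : LeftMinimal I M) {w : ℕ → A}
    {B : Matrix (Fin n) (Fin n) ℝ}
    (hB : Tendsto (fun k => wordProd M (pref w k)) atTop (𝓝 B)) (v : List A) :
    B *ᵥ (wordProd M v *ᵥ F) = B *ᵥ F := by
  refine hl.eq_of_dotProduct_eq fun u => sub_eq_zero.1 ?_
  have key (y : Fin n → ℝ) := ((continuous_dotProduct_mulVec (I ᵥ* wordProd M u) y).tendsto B).comp hB
  refine tendsto_nhds_unique ((key (wordProd M v *ᵥ F)).sub (key F)) ?_
  refine (hA.tendsto_append_sub u v w).congr fun k => ?_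
  simp only [wfaWord, wordProd_append, Function.comp_apply, ← dotProduct_mulVec, mulVec_mulVec,
    Matrix.mul_assoc]

/-- The row vectors `x` that are constant on the vectors `A_v F`. -/
def constantRows {A : Type*} {n : ℕ} (M : A → Matrix (Fin n) (Fin n) ℝ) (F : Fin n → ℝ) :
    Submodule ℝ (Fin n → ℝ) where
  carrier := {x | ∀ v, x ⬝ᵥ (wordProd M v *ᵥ F) = x ⬝ᵥ F}
  zero_mem' := by simp
  add_mem' ha hb v := by rw [add_dotProduct, add_dotProduct, ha v, hb v]
  smul_mem' c a ha v := by rw [smul_dotProduct, smul_dotProduct, ha v]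

lemma vecMul_wordProd_of_mem_constantRows {A : Type*} {n : ℕ}
    {M : A → Matrix (Fin n) (Fin n) ℝ} {F : Fin n → ℝ} (hr : RightMinimal M F)
    {x : Fin n → ℝ} (hx : x ∈ constantRows M F) (p : List A) : x ᵥ* wordProd M p = x := by
  refine hr.eq_of_dotProduct_eq fun v => ?_
  rw [← dotProduct_mulVec, mulVec_mulVec, ← wordProd_append, hx, hx]

lemma finrank_constantRows {A : Type*} {n : ℕ}
    {M : A → Matrix (Fin n) (Fin n) ℝ} {F : Fin n → ℝ} (hr : RightMinimal M F)
    {x : Fin n → ℝ} (hx : x ∈ constantRows M F) (hxF : x ⬝ᵥ F ≠ 0) :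
    Module.finrank ℝ (constantRows M F) = 1 := by
  refine finrank_eq_one ⟨x, hx⟩ (fun h => hxF ?_) fun y => ⟨y.1 ⬝ᵥ F / x ⬝ᵥ F, Subtype.ext ?_⟩
  · simp [show x = 0 from congrArg Subtype.val h]
  · refine hr.eq_of_dotProduct_eq fun v => ?_
    change ((y.1 ⬝ᵥ F / x ⬝ᵥ F) • x) ⬝ᵥ _ = _
    rw [smul_dotProduct, hx v, y.2 v, smul_eq_mul, div_mul_cancel₀ _ hxF]

/-- Let `𝒜 = (I, (A_a), F)` be a minimal, uniformly convergent WFA whose ω-function is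
not identically zero, and let `A_w = lim_k A_{pref_k(w)}`.  Then the row space of `A_w`
is one-dimensional, and it is the same subspace of `ℝⁿ` for every `w ∈ Σ^ω`. -/
theorem row_space_one_dimensional
    {A : Type*} [Fintype A] [Nonempty A]
    {n : ℕ} (I : Fin n → ℝ) (M : A → Matrix (Fin n) (Fin n) ℝ) (F : Fin n → ℝ)
    (hl : LeftMinimal I M) (hr : RightMinimal M F)
    (f : (ℕ → A) → ℝ) (hA : UnifConv (wfaWord I M F) f)
    (hne : ∃ w : ℕ → A, f w ≠ 0)
    (Aω : (ℕ → A) → Matrix (Fin n) (Fin n) ℝ)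
    (hAω : ∀ w : ℕ → A, Tendsto (fun k => wordProd M (pref w k)) atTop (𝓝 (Aω w))) :
    ∃ V : Submodule ℝ (Fin n → ℝ), Module.finrank ℝ V = 1 ∧
      ∀ w : ℕ → A,
        Submodule.span ℝ (Set.range (fun i : Fin n => (Aω w i : Fin n → ℝ))) = V := by
  have hrow (w : ℕ → A) (i : Fin n) : Aω w i ∈ constantRows M F := fun v =>
    congrFun (hA.mulVec_wordProd_mulVec hl (hAω w) v) i
  refine ⟨constantRows M F, ?_, fun w => le_antisymm ?_ fun x hx => ?_⟩
  · obtain ⟨w, hw⟩ := hne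
    have hf : f w = I ⬝ᵥ Aω w *ᵥ F := tendsto_nhds_unique (hA.1 w)
      (((continuous_dotProduct_mulVec I F).tendsto _).comp (hAω w))
    obtain ⟨i, hi⟩ : ∃ i, (Aω w *ᵥ F) i ≠ 0 := by
      by_contra! h
      exact hw (by rw [hf, funext h]; exact dotProduct_zero I)
    exact finrank_constantRows hr (hrow w i) hi
  · rw [Submodule.span_le]
    rintro _ ⟨i, rfl⟩
    exact hrow w i
  · have hcont : Continuous fun B : Matrix (Fin n) (Fin n) ℝ => x ᵥ* B := by fun_prop
    have hlim : Tendsto (fun _ : ℕ => x) atTop (𝓝 (x ᵥ* Aω w)) :=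
      ((hcont.tendsto _).comp (hAω w)).congr fun k =>
        vecMul_wordProd_of_mem_constantRows hr hx (pref w k)
    rw [tendsto_nhds_unique tendsto_const_nhds hlim, vecMul_eq_sum]
    exact Submodule.sum_mem _ fun i _ =>
      Submodule.smul_mem _ _ (Submodule.subset_span ⟨i, rfl⟩)
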